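/- arXiv:1203.5659 — 7 statements merged into one kernel-verified Lean document; each statement's English description precedes it below -/
import Mathlib

section
/- For every two-particle density matrix Γ with the fermionic symmetries and trace normalization, the matrix G(Γ) is positive semidefinite if and only if the matrix G′(Γ) is positive semidefinite. (Hence imposing the G′ condition in the variational optimization is equivalent to imposing the linear G condition.) -/
open Matrix

/-- The fermionic symmetries of a two-particle density matrix:
antisymmetry in the row pair, antisymmetry in the column pair, and symmetry
under exchange of row and column pairs. -/
def FermionicSym {ι : Type*} (Γ : Matrix (ι × ι) (ι × ι) ℝ) : Prop :=
  ∀ α β γ δ : ι,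
    Γ (α, β) (γ, δ) = -Γ (β, α) (γ, δ) ∧
    Γ (α, β) (γ, δ) = -Γ (α, β) (δ, γ) ∧
    Γ (α, β) (γ, δ) = Γ (γ, δ) (α, β)

/-- The trace normalization of a two-particle density matrix for `N` particles:
`(1/2)·Σ_{α,β} Γ_{(α,β),(α,β)} = N(N−1)/2`. -/
def TraceNorm {ι : Type*} [Fintype ι] (N : ℕ) (Γ : Matrix (ι × ι) (ι × ι) ℝ) : Prop :=
  (1 / 2 : ℝ) * (∑ α : ι, ∑ β : ι, Γ (α, β) (α, β)) = (N : ℝ) * ((N : ℝ) - 1) / 2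

/-- The one-particle density matrix derived from a two-particle density matrix:
`ρ_{αγ} = (N−1)⁻¹ · Σ_β Γ_{(α,β),(γ,β)}`. -/
noncomputable def rho1 {ι : Type*} [Fintype ι] (N : ℕ)
    (Γ : Matrix (ι × ι) (ι × ι) ℝ) : Matrix ι ι ℝ :=
  fun α γ => ((N : ℝ) - 1)⁻¹ * ∑ β : ι, Γ (α, β) (γ, β)

/-- The particle-hole map `G(Γ)_{(α,β),(γ,δ)} = δ_{βδ}·ρ_{αγ} − Γ_{(α,δ),(γ,β)}`. -/
noncomputable def Gmap {ι : Type*} [Fintype ι] [DecidableEq ι] (N : ℕ)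
    (Γ : Matrix (ι × ι) (ι × ι) ℝ) : Matrix (ι × ι) (ι × ι) ℝ :=
  fun p q => (if p.2 = q.2 then rho1 N Γ p.1 q.1 else 0) - Γ (p.1, q.2) (q.1, p.2)

/-- The primed particle-hole map
`G′(Γ)_{(α,β),(γ,δ)} = G(Γ)_{(α,β),(γ,δ)} − ρ_{αβ}·ρ_{γδ}`. -/
noncomputable def Gpmap {ι : Type*} [Fintype ι] [DecidableEq ι] (N : ℕ)
    (Γ : Matrix (ι × ι) (ι × ι) ℝ) : Matrix (ι × ι) (ι × ι) ℝ :=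
  fun p q => Gmap N Γ p q - rho1 N Γ p.1 p.2 * rho1 N Γ q.1 q.2

/-- If a positive semidefinite matrix `A` maps `e` to `c • v` with `v ⬝ᵥ e = c ≠ 0`, then
subtracting the rank-one matrix `v vᵀ` preserves positive semidefiniteness. -/
theorem Matrix.PosSemidef.sub_vecMulVec_self {n : Type*} [Fintype n] {A : Matrix n n ℝ}
    (hA : A.PosSemidef) {v e : n → ℝ} {c : ℝ} (hc : c ≠ 0) (hAe : A *ᵥ e = c • v)
    (hve : v ⬝ᵥ e = c) : (A - vecMulVec v v).PosSemidef := by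
  have hvv : (vecMulVec v v).PosSemidef := by
    simpa using posSemidef_vecMulVec_self_star v
  refine PosSemidef.of_dotProduct_mulVec_nonneg (hA.isHermitian.sub hvv.isHermitian) fun x ↦ ?_
  have hAt : Aᵀ = A := by simpa [conjTranspose_eq_transpose_of_trivial] using hA.isHermitian.eq
  have heA : e ⬝ᵥ (A *ᵥ x) = c * (v ⬝ᵥ x) := by
    rw [dotProduct_mulVec, ← mulVec_transpose, hAt, hAe, smul_dotProduct, smul_eq_mul]
  have h := hA.dotProduct_mulVec_nonneg (x - ((v ⬝ᵥ x) / c) • e)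
  simp only [star_trivial, mulVec_sub, mulVec_smul, sub_dotProduct, dotProduct_sub,
    smul_dotProduct, dotProduct_smul, smul_eq_mul, heA, hAe, dotProduct_comm e v,
    dotProduct_comm x v, hve] at h
  simp only [star_trivial, sub_mulVec, dotProduct_sub, vecMulVec_mulVec, dotProduct_smul,
    op_smul_eq_smul, smul_eq_mul, dotProduct_comm x v]
  refine h.trans_eq ?_
  field_simp
  ring

section ParticleHole

variable {ι : Type*} [Fintype ι]

theorem trace_rho1 {N : ℕ} (hN : 2 ≤ N) {Γ : Matrix (ι × ι) (ι × ι) ℝ} (htr : TraceNorm N Γ) :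
    ∑ α, rho1 N Γ α α = N := by
  have hN' : (N : ℝ) - 1 ≠ 0 := by
    have : (2 : ℝ) ≤ N := by exact_mod_cast hN
    linarith
  unfold TraceNorm at htr
  simp only [rho1, ← Finset.mul_sum]
  rw [inv_mul_eq_iff_eq_mul₀ hN']
  linarith

variable [DecidableEq ι]

theorem Gmap_mulVec_one {N : ℕ} (hN : 2 ≤ N) {Γ : Matrix (ι × ι) (ι × ι) ℝ}
    (hsym : FermionicSym Γ) :
    Gmap N Γ *ᵥ (fun p ↦ (1 : Matrix ι ι ℝ) p.1 p.2) =
      (N : ℝ) • fun p : ι × ι ↦ rho1 N Γ p.1 p.2 := by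
  have hN' : (N : ℝ) - 1 ≠ 0 := by
    have : (2 : ℝ) ≤ N := by exact_mod_cast hN
    linarith
  ext ⟨α, β⟩
  have hρ : ∑ γ, Γ (α, γ) (β, γ) = (N - 1) * rho1 N Γ α β := by
    rw [rho1, mul_inv_cancel_left₀ hN']
  have hΓ : ∑ γ, Γ (α, γ) (γ, β) = -∑ γ, Γ (α, γ) (β, γ) := by
    rw [← Finset.sum_neg_distrib]
    exact Finset.sum_congr rfl fun γ _ ↦ (hsym α γ γ β).2.1
  simp only [mulVec, dotProduct, Fintype.sum_prod_type, one_apply, mul_ite, mul_one, mul_zero,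
    Finset.sum_ite_eq, Finset.mem_univ, if_true, Gmap, Finset.sum_sub_distrib, hΓ, hρ,
    Pi.smul_apply, smul_eq_mul]
  ring

theorem Gpmap_eq_sub_vecMulVec (N : ℕ) (Γ : Matrix (ι × ι) (ι × ι) ℝ) :
    Gpmap N Γ = Gmap N Γ - vecMulVec (fun p ↦ rho1 N Γ p.1 p.2) (fun p ↦ rho1 N Γ p.1 p.2) :=
  rfl

end ParticleHole

/-- For every two-particle density matrix `Γ` with the fermionic symmetries and
trace normalization, `G(Γ)` is positive semidefinite iff `G′(Γ)` is positive
semidefinite. -/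
theorem Gprime_posSemidef_iff_G_posSemidef
    {ι : Type*} [Fintype ι] [DecidableEq ι] (N : ℕ) (hN : 2 ≤ N)
    (Γ : Matrix (ι × ι) (ι × ι) ℝ) (hsym : FermionicSym Γ) (htr : TraceNorm N Γ) :
    (Gmap N Γ).PosSemidef ↔ (Gpmap N Γ).PosSemidef := by
  rw [Gpmap_eq_sub_vecMulVec]
  constructor
  · intro h
    refine h.sub_vecMulVec_self (Nat.cast_ne_zero.mpr (by omega)) (Gmap_mulVec_one hN hsym) ?_
    simpa [dotProduct, Fintype.sum_prod_type, one_apply] using trace_rho1 hN htr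
  · intro h
    simpa using h.add (posSemidef_vecMulVec_self_star fun p : ι × ι ↦ rho1 N Γ p.1 p.2)
end

section
/- Coleman's characterization of ensemble N-representable one-particle density matrices (convexity part): let ρ be an M × M Hermitian complex matrix such that both ρ and 1 − ρ are positive semidefinite and Tr ρ = N, where N is a natural number with N ≤ M. Then ρ is a convex combination of Hermitian orthogonal projections of rank N: there exist finitely many matrices P_k with P_k Hermitian, P_k² = P_k, Tr P_k = N, and weights w_k ≥ 0 with Σ_k w_k = 1, such that ρ = Σ_k w_k P_k. -/
open Matrix
open scoped ComplexOrder

/-- If `x ∈ [0, 1]^ι` has two fractional coordinates `i ≠ j`, mass can be moved from `j` to `i`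
until one of them becomes integral. -/
theorem exists_transfer_fractional {ι : Type*} [Fintype ι] [DecidableEq ι] {x : ι → ℝ}
    (h0 : ∀ l, 0 ≤ x l) (h1 : ∀ l, x l ≤ 1) {i j : ι} (hij : i ≠ j)
    (hi : 0 < x i ∧ x i < 1) (hj : 0 < x j ∧ x j < 1) :
    ∃ t : ℝ, 0 < t ∧ ∃ y : ι → ℝ, y = x + t • (Pi.single i 1 - Pi.single j 1) ∧
      (∀ l, 0 ≤ y l) ∧ (∀ l, y l ≤ 1) ∧ ∑ l, y l = ∑ l, x l ∧
      (Finset.univ.filter fun l => 0 < y l ∧ y l < 1).card <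
        (Finset.univ.filter fun l => 0 < x l ∧ x l < 1).card := by
  refine ⟨min (1 - x i) (x j), lt_min (by linarith) hj.1, _, rfl, ?_⟩
  set t := min (1 - x i) (x j) with ht
  have ht0 : 0 < t := lt_min (by linarith) hj.1
  have hti : t ≤ 1 - x i := min_le_left _ _
  have htj : t ≤ x j := min_le_right _ _
  have hyi : (x + t • (Pi.single i 1 - Pi.single j 1) : ι → ℝ) i = x i + t := by
    simp [hij]
  have hyj : (x + t • (Pi.single i 1 - Pi.single j 1) : ι → ℝ) j = x j - t := by
    simp [hij.symm, sub_eq_add_neg]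
  have hyl : ∀ l, l ≠ i → l ≠ j →
      (x + t • (Pi.single i 1 - Pi.single j 1) : ι → ℝ) l = x l := by
    intro l hli hlj
    simp [hli, hlj]
  have hsum : ∑ l, (x + t • (Pi.single i 1 - Pi.single j 1) : ι → ℝ) l = ∑ l, x l := by
    simp [Finset.sum_add_distrib, ← Finset.mul_sum, Finset.sum_sub_distrib]
  generalize (x + t • (Pi.single i 1 - Pi.single j 1) : ι → ℝ) = y at *
  refine ⟨fun l => ?_, fun l => ?_, hsum, Finset.card_lt_card ?_⟩
  · by_cases hli : l = i
    · subst hli; linarith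
    by_cases hlj : l = j
    · subst hlj; linarith
    rw [hyl l hli hlj]; exact h0 l
  · by_cases hli : l = i
    · subst hli; linarith
    by_cases hlj : l = j
    · subst hlj; linarith
    rw [hyl l hli hlj]; exact h1 l
  · rw [Finset.ssubset_iff_of_subset]
    · rcases min_choice (1 - x i) (x j) with h | h
      · exact ⟨i, by simpa using hi, by simp only [Finset.mem_filter]; grind⟩
      · exact ⟨j, by simpa using hj, by simp only [Finset.mem_filter]; grind⟩
    · intro l
      simp only [Finset.mem_filter, Finset.mem_univ, true_and]
      by_cases hli : l = i
      · subst hli; exact fun _ => hi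
      by_cases hlj : l = j
      · subst hlj; exact fun _ => hj
      rw [hyl l hli hlj]; exact id

/-- A vector in `[0, 1]^ι` with integral coordinate sum cannot have exactly one fractional
coordinate. -/
theorem exists_ne_fractional_of_sum_eq_natCast {ι : Type*} [Fintype ι] [DecidableEq ι] {x : ι → ℝ}
    (h0 : ∀ l, 0 ≤ x l) (h1 : ∀ l, x l ≤ 1) {N : ℕ} (hsum : ∑ l, x l = N) {i : ι}
    (hi : 0 < x i ∧ x i < 1) : ∃ j, i ≠ j ∧ 0 < x j ∧ x j < 1 := by
  by_contra! h
  have hz : ∀ l, l ≠ i → x l = ((if x l = 0 then 0 else 1 : ℤ) : ℝ) := by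
    intro l hl
    split_ifs with hl0
    · simpa using hl0
    · simpa using le_antisymm (h1 l) (h l hl.symm ((h0 l).lt_of_ne' hl0))
  rw [← Finset.add_sum_erase _ _ (Finset.mem_univ i),
    Finset.sum_congr rfl fun l hl => hz l (Finset.ne_of_mem_erase hl), ← Int.cast_sum] at hsum
  generalize ∑ l ∈ Finset.univ.erase i, (if x l = 0 then 0 else 1 : ℤ) = z at hsum
  have hlt : ((0 : ℤ) : ℝ) < ((N - z : ℤ) : ℝ) := by push_cast; linarith
  have hgt : ((N - z : ℤ) : ℝ) < ((1 : ℤ) : ℝ) := by push_cast; linarith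
  rw [Int.cast_lt] at hlt hgt
  lia

/-- The hypersimplex is the convex hull of its `0`-`1` points. -/
theorem mem_convexHull_zero_one_of_sum_eq_natCast {ι : Type*} [Fintype ι] {N : ℕ} (x : ι → ℝ)
    (h0 : ∀ l, 0 ≤ x l) (h1 : ∀ l, x l ≤ 1) (hsum : ∑ l, x l = N) :
    x ∈ convexHull ℝ {y : ι → ℝ | (∀ l, y l = 0 ∨ y l = 1) ∧ ∑ l, y l = N} := by
  classical
  induction hn : (Finset.univ.filter fun l => 0 < x l ∧ x l < 1).card
    using Nat.strong_induction_on generalizing x with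
  | _ n ih =>
    by_cases hx : ∀ l, x l = 0 ∨ x l = 1
    · exact subset_convexHull ℝ _ ⟨hx, hsum⟩
    push Not at hx
    obtain ⟨i, hi0, hi1⟩ := hx
    have hi : 0 < x i ∧ x i < 1 := ⟨(h0 i).lt_of_ne' hi0, (h1 i).lt_of_ne hi1⟩
    obtain ⟨j, hij, hj⟩ := exists_ne_fractional_of_sum_eq_natCast h0 h1 hsum hi
    obtain ⟨t, ht, y, hy, hy0, hy1, hys, hyc⟩ := exists_transfer_fractional h0 h1 hij hi hj
    obtain ⟨s, hs, z, hz, hz0, hz1, hzs, hzc⟩ := exists_transfer_fractional h0 h1 hij.symm hj hi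
    have hst : s + t ≠ 0 := by positivity
    have hxyz : x = (s / (s + t)) • y + (t / (s + t)) • z := by
      ext l
      simp only [hy, hz, Pi.add_apply, Pi.smul_apply, Pi.sub_apply, smul_eq_mul]
      field_simp
      ring
    rw [hxyz]
    exact convex_convexHull ℝ _ (ih _ (hn ▸ hyc) y hy0 hy1 (hys.trans hsum) rfl)
      (ih _ (hn ▸ hzc) z hz0 hz1 (hzs.trans hsum) rfl) (by positivity) (by positivity)
      (by field_simp)

/-- If `1 - A` is positive semidefinite, the eigenvalues of `A` are at most `1`. -/
theorem Matrix.IsHermitian.eigenvalues_le_one_of_posSemidef_one_sub {n 𝕜 : Type*} [Fintype n]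
    [DecidableEq n] [RCLike 𝕜] {A : Matrix n n 𝕜} (hA : A.IsHermitian)
    (h : (1 - A).PosSemidef) (i : n) : hA.eigenvalues i ≤ 1 := by
  have hconj : 1 - A = Unitary.conjStarAlgAut 𝕜 (Matrix n n 𝕜) hA.eigenvectorUnitary
      (diagonal fun i => 1 - (hA.eigenvalues i : 𝕜)) := by
    conv_lhs => rw [hA.spectral_theorem, ← map_one (Unitary.conjStarAlgAut 𝕜 (Matrix n n 𝕜)
      hA.eigenvectorUnitary), ← map_sub, ← diagonal_one, diagonal_sub]
    rfl
  rw [hconj, Unitary.conjStarAlgAut_apply,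
    Unitary.isUnit_coe.posSemidef_star_right_conjugate_iff, posSemidef_diagonal_iff] at h
  have hi := h i
  rw [sub_nonneg] at hi
  exact_mod_cast hi

/-- Coleman's characterization of ensemble N-representable one-particle density
matrices (convexity part): a Hermitian `M × M` complex matrix `ρ` with
`ρ ⪰ 0`, `1 − ρ ⪰ 0` and `Tr ρ = N ≤ M` is a convex combination of Hermitian
rank-`N` orthogonal projections (Slater 1DM's). -/
theorem oneDM_convex_combination_of_slater_projections
    (M N : ℕ) (hNM : N ≤ M) (ρ : Matrix (Fin M) (Fin M) ℂ)
    (hherm : ρ.IsHermitian) (hpsd : ρ.PosSemidef)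
    (hq : ((1 : Matrix (Fin M) (Fin M) ℂ) - ρ).PosSemidef)
    (htr : ρ.trace = (N : ℂ)) :
    ∃ (k : ℕ) (w : Fin k → ℝ) (P : Fin k → Matrix (Fin M) (Fin M) ℂ),
      (∀ i, 0 ≤ w i) ∧ (∑ i, w i = 1) ∧
      (∀ i, (P i).IsHermitian) ∧ (∀ i, P i * P i = P i) ∧
      (∀ i, (P i).trace = (N : ℂ)) ∧
      ρ = ∑ i, (w i : ℂ) • P i := by
  have htr' : ∑ l, hherm.eigenvalues l = N := by
    have h := congrArg Complex.re (hherm.trace_eq_sum_eigenvalues.symm.trans htr)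
    simpa using h
  obtain ⟨ι, _, w, z, hw0, hw1, hz, hwz⟩ := mem_convexHull_iff_exists_fintype.1
    (mem_convexHull_zero_one_of_sum_eq_natCast hherm.eigenvalues hpsd.eigenvalues_nonneg
      (hherm.eigenvalues_le_one_of_posSemidef_one_sub hq) htr')
  let e := (Fintype.equivFin ι).symm
  set φ := Unitary.conjStarAlgAut ℂ (Matrix (Fin M) (Fin M) ℂ) hherm.eigenvectorUnitary with hφ
  refine ⟨Fintype.card ι, w ∘ e, fun k => φ (diagonal fun l => (z (e k) l : ℂ)), fun k => hw0 _,
    (e.sum_comp w).trans hw1, fun k => ?_, fun k => ?_, fun k => ?_, ?_⟩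
  · rw [IsHermitian, ← star_eq_conjTranspose, ← map_star, star_eq_conjTranspose,
      diagonal_conjTranspose]
    congr 2
    ext l
    simp
  · rw [← map_mul, diagonal_mul_diagonal]
    congr 2
    ext l
    rcases (hz (e k)).1 l with h | h <;> simp [h]
  · beta_reduce
    rw [hφ, Unitary.conjStarAlgAut_apply, trace_mul_cycle, Unitary.coe_star_mul_self, one_mul,
      trace_diagonal]
    exact_mod_cast (hz (e k)).2
  · conv_lhs => rw [hherm.spectral_theorem, ← hφ, ← hwz]
    simp only [Function.comp_apply]
    rw [e.sum_comp fun a => (w a : ℂ) • φ (diagonal fun l => (z a l : ℂ))]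
    simp_rw [← map_smul, ← map_sum]
    congr 1
    ext a b
    rcases eq_or_ne a b with rfl | hab
    · simp [Matrix.sum_apply]
    · simp [Matrix.sum_apply, hab]
end

section
/- The inverse of a generalized Q map is another generalized Q map: let a, b, c be real numbers with a ≠ 0, a − c(M−2) ≠ 0, and a + b·M(M−1) − 2c(M−1) ≠ 0. Set a′ = 1/a, b′ = (ba + bcM − 2c²) / ( a·[c(M−2) − a]·[a + b·M(M−1) − 2c(M−1)] ), and c′ = c / ( a·[c(M−2) − a] ). Then for every Γ : Matrix (ι × ι) (ι × ι) ℝ one has Q(a′,b′,c′)(Q(a,b,c)(Γ)) = Γ and Q(a,b,c)(Q(a′,b′,c′)(Γ)) = Γ; that is, Q(a,b,c) is a linear bijection with inverse Q(a′,b′,c′). -/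
open Matrix

/-- The partial trace of a matrix on pair indices:
`Γ̄_{αγ} = Σ_λ Γ_{(α,λ),(γ,λ)}`. -/
def pTr {ι : Type*} [Fintype ι] (Γ : Matrix (ι × ι) (ι × ι) ℝ) : Matrix ι ι ℝ :=
  fun α γ => ∑ l : ι, Γ (α, l) (γ, l)

/-- The double trace `Γ̄̄ = Σ_α Γ̄_{αα}`. -/
def dTr {ι : Type*} [Fintype ι] (Γ : Matrix (ι × ι) (ι × ι) ℝ) : ℝ :=
  ∑ α : ι, pTr Γ α α

/-- The generalized `Q` map with coefficients `(a, b, c)`: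
`Q(a,b,c)(Γ)_{(α,β),(γ,δ)} = a·Γ_{(α,β),(γ,δ)}
  + b·(δ_{αγ}δ_{βδ} − δ_{αδ}δ_{βγ})·Γ̄̄
  − c·(δ_{αγ}Γ̄_{βδ} − δ_{βγ}Γ̄_{αδ} − δ_{αδ}Γ̄_{βγ} + δ_{βδ}Γ̄_{αγ})`. -/
def Qgen {ι : Type*} [Fintype ι] [DecidableEq ι] (a b c : ℝ)
    (Γ : Matrix (ι × ι) (ι × ι) ℝ) : Matrix (ι × ι) (ι × ι) ℝ :=
  fun p q =>
    a * Γ p q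
    + b * ((if p.1 = q.1 then (1 : ℝ) else 0) * (if p.2 = q.2 then (1 : ℝ) else 0)
        - (if p.1 = q.2 then (1 : ℝ) else 0) * (if p.2 = q.1 then (1 : ℝ) else 0)) * dTr Γ
    - c * ((if p.1 = q.1 then (1 : ℝ) else 0) * pTr Γ p.2 q.2
        - (if p.2 = q.1 then (1 : ℝ) else 0) * pTr Γ p.1 q.2
        - (if p.1 = q.2 then (1 : ℝ) else 0) * pTr Γ p.2 q.1
        + (if p.2 = q.2 then (1 : ℝ) else 0) * pTr Γ p.1 q.1)

/-- The partial trace of `Q(a,b,c)(Γ)`. -/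
theorem pTr_Qgen {ι : Type*} [Fintype ι] [DecidableEq ι] (a b c : ℝ)
    (Γ : Matrix (ι × ι) (ι × ι) ℝ) (α γ : ι) :
    pTr (Qgen a b c Γ) α γ =
      (a - c * ((Fintype.card ι : ℝ) - 2)) * pTr Γ α γ
        + (b * ((Fintype.card ι : ℝ) - 1) - c) * dTr Γ * (if α = γ then 1 else 0) := by
  have h : ∀ l : ι, Qgen a b c Γ (α, l) (γ, l) =
      a * Γ (α, l) (γ, l)
        + b * dTr Γ * ((if α = γ then 1 else 0)
          - (if α = l then (if l = γ then 1 else 0) else 0))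
        - c * ((if α = γ then 1 else 0) * pTr Γ l l
          - (if l = γ then pTr Γ α l else 0)
          - (if α = l then pTr Γ l γ else 0) + pTr Γ α γ) := by
    intro l
    simp only [Qgen, if_true, ite_mul, one_mul, zero_mul, mul_one]
    ring
  rw [pTr, Finset.sum_congr rfl fun l _ => h l]
  simp only [Finset.sum_add_distrib, Finset.sum_sub_distrib, ← Finset.mul_sum,
    Finset.sum_ite_eq, Finset.sum_ite_eq', Finset.mem_univ, if_true, Finset.sum_const,
    Finset.card_univ, nsmul_eq_mul]
  rw [show ∑ l, Γ (α, l) (γ, l) = pTr Γ α γ from rfl, show ∑ l, pTr Γ l l = dTr Γ from rfl]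
  ring

/-- The double trace of `Q(a,b,c)(Γ)`. -/
theorem dTr_Qgen {ι : Type*} [Fintype ι] [DecidableEq ι] (a b c : ℝ)
    (Γ : Matrix (ι × ι) (ι × ι) ℝ) :
    dTr (Qgen a b c Γ) =
      (a + b * (Fintype.card ι : ℝ) * ((Fintype.card ι : ℝ) - 1)
        - 2 * c * ((Fintype.card ι : ℝ) - 1)) * dTr Γ := by
  rw [dTr]
  simp only [pTr_Qgen, if_true, Finset.sum_add_distrib, ← Finset.mul_sum, Finset.sum_const,
    Finset.card_univ, nsmul_eq_mul]
  rw [show ∑ l, pTr Γ l l = dTr Γ from rfl]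
  ring

/-- The composition of two generalized `Q` maps is a generalized `Q` map. -/
theorem Qgen_Qgen {ι : Type*} [Fintype ι] [DecidableEq ι] (a b c a₂ b₂ c₂ : ℝ)
    (Γ : Matrix (ι × ι) (ι × ι) ℝ) :
    Qgen a₂ b₂ c₂ (Qgen a b c Γ) =
      Qgen (a₂ * a)
        (a₂ * b + b₂ * (a + b * (Fintype.card ι : ℝ) * ((Fintype.card ι : ℝ) - 1)
          - 2 * c * ((Fintype.card ι : ℝ) - 1))
          - 2 * c₂ * (b * ((Fintype.card ι : ℝ) - 1) - c))
        (a₂ * c + c₂ * (a - c * ((Fintype.card ι : ℝ) - 2))) Γ := by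
  ext p q
  rw [Qgen, pTr_Qgen, pTr_Qgen, pTr_Qgen, pTr_Qgen, dTr_Qgen, Qgen, Qgen]
  ring

theorem Qgen_one_zero_zero {ι : Type*} [Fintype ι] [DecidableEq ι]
    (Γ : Matrix (ι × ι) (ι × ι) ℝ) : Qgen 1 0 0 Γ = Γ := by
  ext p q
  simp [Qgen]

/-- The inverse of a generalized `Q` map is another generalized `Q` map: with
`a′ = 1/a`, `b′ = (ba + bcM − 2c²)/(a·[c(M−2) − a]·[a + bM(M−1) − 2c(M−1)])`
and `c′ = c/(a·[c(M−2) − a])`, the maps `Q(a,b,c)` and `Q(a′,b′,c′)` are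
mutually inverse linear bijections. -/
theorem Qgen_inverse
    {ι : Type*} [Fintype ι] [DecidableEq ι] (a b c : ℝ)
    (M : ℝ) (hM : M = (Fintype.card ι : ℝ))
    (ha : a ≠ 0)
    (h1 : a - c * (M - 2) ≠ 0)
    (h2 : a + b * M * (M - 1) - 2 * c * (M - 1) ≠ 0)
    (Γ : Matrix (ι × ι) (ι × ι) ℝ) :
    Qgen (1 / a)
        ((b * a + b * c * M - 2 * c ^ 2) /
          (a * (c * (M - 2) - a) * (a + b * M * (M - 1) - 2 * c * (M - 1))))
        (c / (a * (c * (M - 2) - a)))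
        (Qgen a b c Γ) = Γ ∧
    Qgen a b c
        (Qgen (1 / a)
          ((b * a + b * c * M - 2 * c ^ 2) /
            (a * (c * (M - 2) - a) * (a + b * M * (M - 1) - 2 * c * (M - 1))))
          (c / (a * (c * (M - 2) - a)))
          Γ) = Γ := by
  have h1' : c * (M - 2) - a ≠ 0 := fun h => h1 (by linarith)
  obtain ⟨t, ht⟩ : ∃ t, t = a + b * M * (M - 1) - 2 * c * (M - 1) := ⟨_, rfl⟩
  rw [← ht] at h2 ⊢
  constructor <;> rw [Qgen_Qgen, ← hM] <;> convert Qgen_one_zero_zero Γ using 2 <;>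
    field_simp <;> subst ht <;> ring
end

section
/- The homogeneous Q condition map is self-adjoint with respect to the two-particle inner product: let N ≥ 2 and let Γ and A both be real matrices on pair indices with the fermionic symmetries. Then ⟨Q(1, 1/(N(N−1)), 1/(N−1))(Γ), A⟩_tp = ⟨Γ, Q(1, 1/(N(N−1)), 1/(N−1))(A)⟩_tp. -/
open Matrix

/-- The two-particle inner product
`⟨A,B⟩_tp = (1/4)·Σ_{α,β,γ,δ} A_{(α,β),(γ,δ)}·B_{(α,β),(γ,δ)}`. -/
noncomputable def tpInner {ι : Type*} [Fintype ι] (A B : Matrix (ι × ι) (ι × ι) ℝ) : ℝ :=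
  (1 / 4 : ℝ) * ∑ α : ι, ∑ β : ι, ∑ γ : ι, ∑ δ : ι, A (α, β) (γ, δ) * B (α, β) (γ, δ)

theorem tpInner_comm {ι : Type*} [Fintype ι] (A B : Matrix (ι × ι) (ι × ι) ℝ) :
    tpInner A B = tpInner B A := by
  simp only [tpInner, mul_comm]

namespace FermionicSym

variable {ι : Type*} {A : Matrix (ι × ι) (ι × ι) ℝ}

theorem swap_left (hA : FermionicSym A) (α β γ δ : ι) :
    A (β, α) (γ, δ) = -A (α, β) (γ, δ) := (hA β α γ δ).1

theorem swap_right (hA : FermionicSym A) (α β γ δ : ι) :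
    A (α, β) (δ, γ) = -A (α, β) (γ, δ) := (hA α β δ γ).2.1

theorem swap_both (hA : FermionicSym A) (α β γ δ : ι) :
    A (β, α) (δ, γ) = A (α, β) (γ, δ) := by
  rw [hA.swap_left, hA.swap_right, neg_neg]

variable [Fintype ι]

theorem sum_diag_left (hA : FermionicSym A) (β δ : ι) :
    ∑ l, A (l, β) (l, δ) = pTr A β δ :=
  Finset.sum_congr rfl fun l _ => hA.swap_both β l δ l

variable [DecidableEq ι]

/-- Contracting `δ ⊗ M` against `A` gives the pairing of `M` with the partial trace of `A`. -/
theorem sum_delta_left (hA : FermionicSym A) (M : Matrix ι ι ℝ) :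
    ∑ α, ∑ β, ∑ γ, ∑ δ, (if α = γ then (1 : ℝ) else 0) * M β δ * A (α, β) (γ, δ) =
      ∑ β, ∑ δ, M β δ * pTr A β δ := by
  simp only [← hA.sum_diag_left, Finset.mul_sum]
  rw [Finset.sum_comm]
  refine Finset.sum_congr rfl fun β _ => ?_
  rw [Finset.sum_comm (s := Finset.univ (α := ι)) (f := fun δ l => M β δ * A (l, β) (l, δ))]
  refine Finset.sum_congr rfl fun α _ => ?_
  rw [Finset.sum_comm]
  simp

theorem sum_delta_inner (hA : FermionicSym A) (M : Matrix ι ι ℝ) :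
    ∑ α, ∑ β, ∑ γ, ∑ δ, (if β = γ then (1 : ℝ) else 0) * M α δ * A (α, β) (γ, δ) =
      -∑ β, ∑ δ, M β δ * pTr A β δ := by
  rw [← hA.sum_delta_left, Finset.sum_comm]
  simp only [← Finset.sum_neg_distrib]
  refine Finset.sum_congr rfl fun β _ => Finset.sum_congr rfl fun α _ =>
    Finset.sum_congr rfl fun γ _ => Finset.sum_congr rfl fun δ _ => ?_
  rw [hA.swap_left β α]
  ring

theorem sum_delta_outer (hA : FermionicSym A) (M : Matrix ι ι ℝ) :
    ∑ α, ∑ β, ∑ γ, ∑ δ, (if α = δ then (1 : ℝ) else 0) * M β γ * A (α, β) (γ, δ) =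
      -∑ β, ∑ δ, M β δ * pTr A β δ := by
  rw [← hA.sum_delta_left]
  simp only [← Finset.sum_neg_distrib]
  refine Finset.sum_congr rfl fun α _ => Finset.sum_congr rfl fun β _ => ?_
  rw [Finset.sum_comm]
  refine Finset.sum_congr rfl fun δ _ => Finset.sum_congr rfl fun γ _ => ?_
  rw [hA.swap_right α β δ γ]
  ring

theorem sum_delta_right (hA : FermionicSym A) (M : Matrix ι ι ℝ) :
    ∑ α, ∑ β, ∑ γ, ∑ δ, (if β = δ then (1 : ℝ) else 0) * M α γ * A (α, β) (γ, δ) =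
      ∑ β, ∑ δ, M β δ * pTr A β δ := by
  rw [← hA.sum_delta_left, Finset.sum_comm]
  refine Finset.sum_congr rfl fun β _ => Finset.sum_congr rfl fun α _ => ?_
  rw [Finset.sum_comm]
  refine Finset.sum_congr rfl fun δ _ => Finset.sum_congr rfl fun γ _ => ?_
  rw [hA.swap_both β α δ γ]

theorem tpInner_Qgen (hA : FermionicSym A) (a b c : ℝ) (Γ : Matrix (ι × ι) (ι × ι) ℝ) :
    tpInner (Qgen a b c Γ) A =
      a * tpInner Γ A + b / 2 * (dTr Γ * dTr A)
        - c * ∑ α, ∑ γ, pTr Γ α γ * pTr A α γ := by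
  have hdirect := hA.sum_delta_left (1 : Matrix ι ι ℝ)
  have hexchange := hA.sum_delta_outer (1 : Matrix ι ι ℝ)
  have htrace : ∑ β, ∑ δ, (1 : Matrix ι ι ℝ) β δ * pTr A β δ = dTr A := by
    simp [Matrix.one_apply, dTr]
  rw [htrace] at hdirect hexchange
  have hexpand (α β γ δ : ι) : Qgen a b c Γ (α, β) (γ, δ) * A (α, β) (γ, δ) =
      a * (Γ (α, β) (γ, δ) * A (α, β) (γ, δ))
      + b * dTr Γ *
        ((if α = γ then (1 : ℝ) else 0) * (1 : Matrix ι ι ℝ) β δ * A (α, β) (γ, δ))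
      - b * dTr Γ *
        ((if α = δ then (1 : ℝ) else 0) * (1 : Matrix ι ι ℝ) β γ * A (α, β) (γ, δ))
      - c * ((if α = γ then (1 : ℝ) else 0) * pTr Γ β δ * A (α, β) (γ, δ))
      + c * ((if β = γ then (1 : ℝ) else 0) * pTr Γ α δ * A (α, β) (γ, δ))
      + c * ((if α = δ then (1 : ℝ) else 0) * pTr Γ β γ * A (α, β) (γ, δ))
      - c * ((if β = δ then (1 : ℝ) else 0) * pTr Γ α γ * A (α, β) (γ, δ)) := by
    simp only [Qgen, Matrix.one_apply]
    ring
  simp only [tpInner, hexpand, Finset.sum_add_distrib, Finset.sum_sub_distrib,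
    ← Finset.mul_sum, hdirect, hexchange, hA.sum_delta_left, hA.sum_delta_inner,
    hA.sum_delta_outer, hA.sum_delta_right]
  ring

end FermionicSym

/-- The homogeneous `Q` condition map `Q(1, 1/(N(N−1)), 1/(N−1))` is
self-adjoint with respect to the two-particle inner product on matrices with
the fermionic symmetries. -/
theorem Qcondition_selfAdjoint
    {ι : Type*} [Fintype ι] [DecidableEq ι] (N : ℕ) (hN : 2 ≤ N)
    (Γ A : Matrix (ι × ι) (ι × ι) ℝ)
    (hΓ : FermionicSym Γ) (hA : FermionicSym A) :
    tpInner (Qgen 1 (1 / ((N : ℝ) * ((N : ℝ) - 1))) (1 / ((N : ℝ) - 1)) Γ) A =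
      tpInner Γ (Qgen 1 (1 / ((N : ℝ) * ((N : ℝ) - 1))) (1 / ((N : ℝ) - 1)) A) := by
  rw [tpInner_comm Γ, hA.tpInner_Qgen, hΓ.tpInner_Qgen, tpInner_comm Γ A, mul_comm (dTr Γ)]
  simp only [mul_comm (pTr Γ _ _)]
end

section
/- Optimality conditions of the dual-only potential reduction method: let u⁰ and u¹, …, u^m be real symmetric n × n matrices, h ∈ ℝ^m, and t > 0. Define Z(γ) := u⁰ + Σᵢ γᵢ uⁱ and, on the open set of γ where Z(γ) is positive definite, the barrier potential φ(γ) := Σᵢ γᵢ hⁱ − t·log det Z(γ). If γ* is a local minimum of φ with Z(γ*) positive definite, then hⁱ = t·Tr( Z(γ*)⁻¹ · uⁱ ) for every i = 1, …, m; consequently the matrix X := t·Z(γ*)⁻¹ is positive definite, is primal feasible (Tr(X uⁱ) = hⁱ for all i), and the primal-dual gap equals Tr( X · Z(γ*) ) = n·t. -/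
open Matrix

/-- The barrier potential `φ(γ) = Σᵢ γᵢ hⁱ − t·log det(u⁰ + Σᵢ γᵢ uⁱ)` of the
dual-only potential reduction method. -/
noncomputable def barrierPhi (n m : ℕ) (u0 : Matrix (Fin n) (Fin n) ℝ)
    (u : Fin m → Matrix (Fin n) (Fin n) ℝ) (hvec : Fin m → ℝ) (t : ℝ)
    (γ : Fin m → ℝ) : ℝ :=
  (∑ i, γ i * hvec i) - t * Real.log (u0 + ∑ i, γ i • u i).det

theorem hasDerivAt_det_one_add_smul {ι : Type*} [Fintype ι] [DecidableEq ι] (M : Matrix ι ι ℝ) :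
    HasDerivAt (fun s : ℝ => (1 + s • M).det) M.trace 0 := by
  have h (s : ℝ) : (1 + s • M).det =
      (det (1 + (Polynomial.X : Polynomial ℝ) • M.map Polynomial.C)).eval s := by
    rw [← Polynomial.coe_evalRingHom, RingHom.map_det]
    congr 1
    ext i j
    by_cases hij : i = j <;> simp [hij, mul_comm s]
  simp_rw [h, ← derivative_det_one_add_X_smul M]
  exact Polynomial.hasDerivAt _ _

/-- Logarithmic form of the Jacobi formula, along a line through an invertible matrix. -/
theorem hasDerivAt_log_det_add_smul {ι : Type*} [Fintype ι] [DecidableEq ι]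
    (Z V : Matrix ι ι ℝ) (hZ : Z.det ≠ 0) :
    HasDerivAt (fun s : ℝ => Real.log (Z + s • V).det) (Z⁻¹ * V).trace 0 := by
  have hfac (s : ℝ) : (Z + s • V).det = Z.det * (1 + s • (Z⁻¹ * V)).det := by
    rw [← det_mul, mul_add, mul_one, mul_smul_comm, mul_nonsing_inv_cancel_left _ _ hZ.isUnit]
  have hd := ((hasDerivAt_det_one_add_smul (Z⁻¹ * V)).const_mul Z.det).log (by simpa using hZ)
  simp_rw [hfac]
  convert hd using 1
  simp [hZ]

theorem hasDerivAt_barrierPhi_add_single (n m : ℕ) (u0 : Matrix (Fin n) (Fin n) ℝ)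
    (u : Fin m → Matrix (Fin n) (Fin n) ℝ) (hvec : Fin m → ℝ) (t : ℝ) (γ : Fin m → ℝ)
    (hdet : (u0 + ∑ j, γ j • u j).det ≠ 0) (i : Fin m) :
    HasDerivAt (fun s : ℝ => barrierPhi n m u0 u hvec t (γ + Pi.single i s))
      (hvec i - t * ((u0 + ∑ j, γ j • u j)⁻¹ * u i).trace) 0 := by
  have heq (s : ℝ) : barrierPhi n m u0 u hvec t (γ + Pi.single i s) =
      (∑ j, γ j * hvec j) + s * hvec i -
        t * Real.log ((u0 + ∑ j, γ j • u j) + s • u i).det := by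
    simp [barrierPhi, add_mul, add_smul, Finset.sum_add_distrib, Pi.single_apply, add_assoc]
  simp_rw [heq]
  have hlin : HasDerivAt (fun s : ℝ => (∑ j, γ j * hvec j) + s * hvec i) (hvec i) 0 := by
    simpa using ((hasDerivAt_id (0 : ℝ)).mul_const (hvec i)).const_add (∑ j, γ j * hvec j)
  exact hlin.sub ((hasDerivAt_log_det_add_smul _ (u i) hdet).const_mul t)

/-- Optimality conditions of the dual-only potential reduction method: at a
local minimum `γ*` of the barrier potential with `Z(γ*) ≻ 0`, one has
`hⁱ = t·Tr(Z(γ*)⁻¹ uⁱ)` for every `i`; consequently `X = t·Z(γ*)⁻¹` is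
positive definite, primal feasible, and the primal-dual gap is
`Tr(X·Z(γ*)) = n·t`. -/
theorem barrier_local_min_optimality
    (n m : ℕ) (u0 : Matrix (Fin n) (Fin n) ℝ) (u : Fin m → Matrix (Fin n) (Fin n) ℝ)
    (hu0 : u0.IsSymm) (hu : ∀ i, (u i).IsSymm)
    (hvec : Fin m → ℝ) (t : ℝ) (ht : 0 < t)
    (γs : Fin m → ℝ)
    (hpd : (u0 + ∑ i, γs i • u i).PosDef)
    (hmin : IsLocalMin (barrierPhi n m u0 u hvec t) γs) :
    (∀ i, hvec i = t * ((u0 + ∑ j, γs j • u j)⁻¹ * u i).trace) ∧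
    (t • (u0 + ∑ j, γs j • u j)⁻¹).PosDef ∧
    (∀ i, ((t • (u0 + ∑ j, γs j • u j)⁻¹) * u i).trace = hvec i) ∧
    ((t • (u0 + ∑ j, γs j • u j)⁻¹) * (u0 + ∑ j, γs j • u j)).trace = (n : ℝ) * t := by
  have hdet : (u0 + ∑ j, γs j • u j).det ≠ 0 := hpd.det_pos.ne'
  have hgrad (i : Fin m) : hvec i = t * ((u0 + ∑ j, γs j • u j)⁻¹ * u i).trace := by
    have hcont : ContinuousAt (fun s : ℝ => γs + Pi.single i s) 0 :=
      (continuous_const.add (continuous_single i)).continuousAt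
    have hloc : IsLocalMin (barrierPhi n m u0 u hvec t ∘ fun s : ℝ => γs + Pi.single i s) 0 :=
      IsLocalMin.comp_continuous (by simpa using hmin) hcont
    exact sub_eq_zero.mp
      (hloc.hasDerivAt_eq_zero (hasDerivAt_barrierPhi_add_single n m u0 u hvec t γs hdet i))
  refine ⟨hgrad, hpd.inv.smul ht, fun i => ?_, ?_⟩
  · rw [smul_mul_assoc, trace_smul, smul_eq_mul, ← hgrad i]
  · rw [smul_mul_assoc, nonsing_inv_mul _ hdet.isUnit, trace_smul, trace_one, Fintype.card_fin,
      smul_eq_mul, mul_comm]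
end

section
/- The positive part of a symmetric matrix is its Frobenius-norm projection onto the positive semidefinite cone: let W be a real symmetric n × n matrix and suppose W = W₊ + W₋ where W₊ is positive semidefinite, W₋ is negative semidefinite (i.e. −W₋ is positive semidefinite), and W₊·W₋ = W₋·W₊ = 0. Then for every positive semidefinite symmetric matrix Z, ‖W − W₊‖_F ≤ ‖W − Z‖_F, i.e. Z = W₊ minimizes ‖Z − W‖_F over the cone of positive semidefinite matrices. -/
open Matrix

/-- The Frobenius norm of a real square matrix, `‖A‖_F = sqrt(Tr(Aᵀ·A))`. -/
noncomputable def frobNorm {n : ℕ} (A : Matrix (Fin n) (Fin n) ℝ) : ℝ :=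
  Real.sqrt (Aᵀ * A).trace

open scoped MatrixOrder Matrix.Norms.L2Operator in
/-- The trace of a product of two positive semidefinite real matrices is nonnegative. -/
theorem Matrix.PosSemidef.trace_mul_nonneg {ι : Type*} [Fintype ι]
    {A B : Matrix ι ι ℝ} (hA : A.PosSemidef) (hB : B.PosSemidef) : 0 ≤ (A * B).trace := by
  classical
  obtain ⟨C, rfl⟩ := CStarAlgebra.nonneg_iff_eq_star_mul_self.mp hA.nonneg
  rw [star_eq_conjTranspose, Matrix.mul_assoc, Matrix.trace_mul_comm]
  exact (hB.mul_mul_conjTranspose_same C).trace_nonneg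

/-- The positive part of a symmetric matrix is its Frobenius-norm projection
onto the positive semidefinite cone: if `W = W₊ + W₋` with `W₊ ⪰ 0`,
`−W₋ ⪰ 0` and `W₊·W₋ = W₋·W₊ = 0`, then for every positive semidefinite `Z`,
`‖W − W₊‖_F ≤ ‖W − Z‖_F`. -/
theorem positive_part_is_psd_projection
    (n : ℕ) (W Wp Wm : Matrix (Fin n) (Fin n) ℝ) (hW : W.IsSymm)
    (hsum : W = Wp + Wm) (hWp : Wp.PosSemidef) (hWm : (-Wm).PosSemidef)
    (hpm : Wp * Wm = 0) (hmp : Wm * Wp = 0) :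
    ∀ Z : Matrix (Fin n) (Fin n) ℝ, Z.PosSemidef →
      frobNorm (W - Wp) ≤ frobNorm (W - Z) := by
  intro Z hZ
  have hWmT : Wmᵀ = Wm := by
    have h : Wpᵀ = Wp := hWp.isHermitian
    have h' := hW.eq
    rw [hsum, transpose_add, h] at h'
    exact add_left_cancel h'
  have hcross : 0 ≤ (Wm * (Wp - Z)).trace := by
    have h := hWm.trace_mul_nonneg hZ
    rwa [Matrix.mul_sub, hmp, zero_sub, ← Matrix.neg_mul]
  have hsq : 0 ≤ ((Wp - Z)ᵀ * (Wp - Z)).trace :=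
    (posSemidef_conjTranspose_mul_self (Wp - Z)).trace_nonneg
  have hcross' : ((Wp - Z)ᵀ * Wm).trace = (Wm * (Wp - Z)).trace := by
    rw [← trace_transpose, transpose_mul, transpose_transpose, hWmT]
  have hl : W - Wp = Wm := by rw [hsum, add_sub_cancel_left]
  have hr : W - Z = Wm + (Wp - Z) := by rw [hsum]; abel
  unfold frobNorm
  apply Real.sqrt_le_sqrt
  rw [hl, hr, transpose_add, Matrix.add_mul, Matrix.mul_add, Matrix.mul_add,
    trace_add, trace_add, trace_add, hcross', hWmT]
  linarith
end

section
/- Canonical pairing form of a two-fermion amplitude (skew-symmetric Youla/Hua decomposition): for every complex n × n matrix B with Bᵀ = −B, there exist a unitary n × n matrix U, a natural number m with 2m ≤ n, and nonnegative real numbers x₁, …, x_m, such that the matrix C := U · B · Uᵀ has entries C_{2k−1, 2k} = x_k and C_{2k, 2k−1} = −x_k for k = 1, …, m, and all other entries of C equal zero. (Physically: every two-fermion creation operator B† = Σ_{αβ} B_{αβ} a†_α a†_β can be brought to diagonal pairing form B† = Σ_α x_α a†_α a†_{ᾱ} by a canonical transformation of the single-particle basis.) -/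
open Matrix

/-- The canonical pairing matrix on `Fin n` built from pair amplitudes
`x : Fin m → ℝ` (with `2m ≤ n` intended): using 0-based indexing, its
`(2k, 2k+1)` entry is `x k`, its `(2k+1, 2k)` entry is `−x k` for `k < m`, and
all other entries vanish. -/
noncomputable def pairingMatrix (n m : ℕ) (x : Fin m → ℝ) :
    Matrix (Fin n) (Fin n) ℂ :=
  fun i j =>
    if h : (i : ℕ) % 2 = 0 ∧ (j : ℕ) = (i : ℕ) + 1 ∧ (i : ℕ) / 2 < m then
      ((x ⟨(i : ℕ) / 2, h.2.2⟩ : ℝ) : ℂ)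
    else if h' : (j : ℕ) % 2 = 0 ∧ (i : ℕ) = (j : ℕ) + 1 ∧ (j : ℕ) / 2 < m then
      (-(x ⟨(j : ℕ) / 2, h'.2.2⟩ : ℝ) : ℂ)
    else 0

open scoped InnerProductSpace

/-- A linear functional bounded by `s` whose value at a unit vector `v` is `s` is `s ⟪v, ·⟫`. -/
theorem eq_smul_inner_of_attains_bound {E : Type*} [NormedAddCommGroup E]
    [InnerProductSpace ℂ E] [FiniteDimensional ℂ E] (f : E →ₗ[ℂ] ℂ) {s : ℝ}
    (hf : ∀ w, ‖f w‖ ≤ s * ‖w‖) {v : E} (hv : ‖v‖ = 1) (hfv : f v = s) (w : E) :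
    f w = s * ⟪v, w⟫_ℂ := by
  have : CompleteSpace E := FiniteDimensional.complete ℂ E
  set a : E := (InnerProductSpace.toDual ℂ E).symm f.toContinuousLinearMap
  have ha (y : E) : ⟪a, y⟫_ℂ = f y := by simp [a]
  have hs : 0 ≤ s := by simpa [hv] using (norm_nonneg _).trans (hf v)
  have hle : ‖a‖ ≤ s := by
    rcases (norm_nonneg a).eq_or_lt with h | h
    · rw [← h]; exact hs
    · have h1 := hf a
      rw [← ha a, inner_self_eq_norm_sq_to_K] at h1
      simp only [Complex.coe_algebraMap, norm_pow, Complex.norm_real, norm_norm] at h1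
      nlinarith
  have hav : a = (s : ℂ) • v := by
    have h := norm_sub_sq (𝕜 := ℂ) a ((s : ℂ) • v)
    rw [inner_smul_right, ha, hfv, norm_smul, hv, ← Complex.ofReal_mul] at h
    simp only [RCLike.re_to_complex, Complex.ofReal_re, Complex.norm_real, Real.norm_eq_abs,
      abs_of_nonneg hs] at h
    have h0 : ‖a - (s : ℂ) • v‖ = 0 := by
      have := norm_nonneg a
      nlinarith [norm_nonneg (a - (s : ℂ) • v)]
    exact sub_eq_zero.1 (norm_eq_zero.1 h0)
  rw [← ha, hav, inner_smul_left, Complex.conj_ofReal]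

/-- A nonzero bilinear form attains its norm at a pair of unit vectors, which represent each
other up to that norm. -/
theorem exists_singular_pair {E : Type*} [NormedAddCommGroup E] [InnerProductSpace ℂ E]
    [FiniteDimensional ℂ E] (b : E →ₗ[ℂ] E →ₗ[ℂ] ℂ) (hb : b ≠ 0) :
    ∃ (s : ℝ) (u v : E), 0 < s ∧ ‖u‖ = 1 ∧ ‖v‖ = 1 ∧
      (∀ w, b u w = s * ⟪v, w⟫_ℂ) ∧ ∀ w, b w v = s * ⟪u, w⟫_ℂ := by
  have : ProperSpace E := FiniteDimensional.proper ℂ E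
  obtain ⟨u₀, v₀, h₀⟩ : ∃ u v, b u v ≠ 0 := by
    by_contra! h
    exact hb (LinearMap.ext₂ h)
  have hu₀ : u₀ ≠ 0 := by rintro rfl; simp at h₀
  have : Nontrivial E := ⟨u₀, 0, hu₀⟩
  have hcont : Continuous fun p : E × E => ‖b p.1 p.2‖ := by
    have h : Continuous fun p : E × E => LinearMap.toContinuousBilinearMap b p.1 p.2 := by
      fun_prop
    exact h.norm
  have hK := (isCompact_sphere (0 : E) 1).prod (isCompact_sphere (0 : E) 1)
  have hne : (Metric.sphere (0 : E) 1).Nonempty := by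
    obtain ⟨z, hz⟩ := exists_norm_eq E zero_le_one
    exact ⟨z, by simpa using hz⟩
  obtain ⟨⟨u, v'⟩, ⟨hu, hv'⟩, hmax⟩ := hK.exists_isMaxOn (hne.prod hne) hcont.continuousOn
  simp only [mem_sphere_iff_norm, sub_zero] at hu hv'
  set s := ‖b u v'‖ with hs
  have hbound (x y : E) : ‖b x y‖ ≤ s * ‖x‖ * ‖y‖ := by
    rcases eq_or_ne x 0 with rfl | hx
    · simp
    rcases eq_or_ne y 0 with rfl | hy
    · simp
    have hx' := norm_pos_iff.2 hx
    have hy' := norm_pos_iff.2 hy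
    have h := @hmax (((‖x‖⁻¹ : ℝ) : ℂ) • x, ((‖y‖⁻¹ : ℝ) : ℂ) • y)
      (by constructor <;> simp [norm_smul, hx'.ne', hy'.ne'])
    simp only [Set.mem_ofPred_eq, map_smul, LinearMap.smul_apply, norm_smul, Complex.norm_real,
      norm_inv, norm_norm] at h
    rw [← hs] at h
    field_simp at h
    linarith
  have hspos : 0 < s := by
    by_contra! h
    have h1 : s = 0 := le_antisymm h (norm_nonneg _)
    exact h₀ (norm_le_zero_iff.1 (by simpa [h1] using hbound u₀ v₀))
  have hc : b u v' ≠ 0 := norm_pos_iff.1 hspos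
  have hs' : (s : ℂ) ≠ 0 := by exact_mod_cast hspos.ne'
  set v : E := ((s : ℂ) / b u v') • v'
  have hv : ‖v‖ = 1 := by
    rw [norm_smul, hv', norm_div, ← hs, Complex.norm_real, Real.norm_of_nonneg hspos.le,
      div_self hspos.ne', mul_one]
  have huv : b u v = s := by simp [v, hc]
  refine ⟨s, u, v, hspos, hu, hv, ?_, ?_⟩
  · exact eq_smul_inner_of_attains_bound (b u) (fun w => by simpa [hu] using hbound u w) hv huv
  · exact eq_smul_inner_of_attains_bound (b.flip v)
      (fun w => by simpa [hv] using hbound w v) hu huv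

theorem pairingMatrix_add_two (n m : ℕ) (s : ℝ) (x : Fin m → ℝ) (i j : Fin n) :
    pairingMatrix (n + 2) (m + 1) (Fin.cons s x) i.succ.succ j.succ.succ =
      pairingMatrix n m x i j := by
  have hx (k : ℕ) (h : (k + 1 + 1) / 2 < m + 1) (h' : k / 2 < m) :
      (Fin.cons s x : Fin (m + 1) → ℝ) ⟨(k + 1 + 1) / 2, h⟩ = x ⟨k / 2, h'⟩ := by
    have : (⟨(k + 1 + 1) / 2, h⟩ : Fin (m + 1)) = Fin.succ ⟨k / 2, h'⟩ := by
      ext; simp only [Fin.val_succ]; omega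
    rw [this, Fin.cons_succ]
  unfold pairingMatrix
  simp only [Fin.val_succ]
  split_ifs
  all_goals first
    | omega
    | rfl
    | rw [hx]

/-- An alternating form on a finite-dimensional complex inner product space has canonical pairing
form in some orthonormal basis. -/
theorem exists_orthonormalBasis_pairing (n : ℕ) : ∀ {E : Type*} [NormedAddCommGroup E]
    [InnerProductSpace ℂ E] [FiniteDimensional ℂ E] (b : E →ₗ[ℂ] E →ₗ[ℂ] ℂ),
    b.IsAlt → Module.finrank ℂ E = n →
    ∃ (e : OrthonormalBasis (Fin n) ℂ E) (m : ℕ) (x : Fin m → ℝ),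
      2 * m ≤ n ∧ (∀ k, 0 ≤ x k) ∧ ∀ i j, b (e i) (e j) = pairingMatrix n m x i j := by
  induction n using Nat.strong_induction_on with
  | _ n ih =>
  intro E _ _ _ b hb hn
  by_cases h0 : b = 0
  · exact ⟨(stdOrthonormalBasis ℂ E).reindex (finCongr hn), 0, Fin.elim0, by simp, by simp,
      by simp [h0, pairingMatrix]⟩
  obtain ⟨s, u, v, hs, hu, hv, hbu, hbv⟩ := exists_singular_pair b h0
  have hs' : (s : ℂ) ≠ 0 := by exact_mod_cast hs.ne'
  have hvu : ⟪v, u⟫_ℂ = 0 := by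
    have := hbu u
    rw [hb.self_eq_zero] at this
    simpa [hs'] using this.symm
  have huv : ⟪u, v⟫_ℂ = 0 := inner_eq_zero_symm.1 hvu
  have hon : Orthonormal ℂ ![u, v] := by
    simp [orthonormal_vecCons_iff, hu, hv, huv]
  set K := Submodule.span ℂ (Set.range ![u, v])
  have hK : Module.finrank ℂ K = 2 := by
    simpa using finrank_span_eq_card hon.linearIndependent
  have hdim := K.finrank_add_finrank_orthogonal
  rw [hK, hn] at hdim
  obtain ⟨k, rfl⟩ : ∃ k, n = k + 2 := ⟨n - 2, by omega⟩
  obtain ⟨e, m, x, hm, hx, he⟩ := ih k (by omega) (b.domRestrict₁₂ Kᗮ Kᗮ)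
    (fun w => hb w) (by omega)
  have hue (i : Fin k) : ⟪u, (e i : E)⟫_ℂ = 0 :=
    (e i).2 u (Submodule.subset_span ⟨0, rfl⟩)
  have hve (i : Fin k) : ⟪v, (e i : E)⟫_ℂ = 0 :=
    (e i).2 v (Submodule.subset_span ⟨1, rfl⟩)
  have hbuv : b u v = s := by simp [hbu, hv]
  have hbvu : b v u = -s := by rw [← hbuv, hb.neg]
  have hbue (i : Fin k) : b u (e i) = 0 := by simp [hbu, hve]
  have hbev (i : Fin k) : b (e i) v = 0 := by simp [hbv, hue]
  have hbeu (i : Fin k) : b (e i) u = 0 := by rw [← hb.neg, hbue, neg_zero]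
  have hbve (i : Fin k) : b v (e i) = 0 := by rw [← hb.neg, hbev, neg_zero]
  set f : Fin (k + 2) → E := vecCons u (vecCons v fun i => (e i : E))
  have hf : Orthonormal ℂ f := by
    have he' : Orthonormal ℂ fun i => (e i : E) :=
      e.orthonormal.comp_linearIsometry Kᗮ.subtypeₗᵢ
    simp only [f, orthonormal_vecCons_iff]
    refine ⟨hu, Fin.cases huv hue, hv, hve, he'⟩
  refine ⟨OrthonormalBasis.mk hf
    (hf.linearIndependent.span_eq_top_of_card_eq_finrank' (by simp [hn])).ge, m + 1,
    Fin.cons s x, by omega, Fin.cases hs.le hx, ?_⟩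
  simp only [OrthonormalBasis.coe_mk]
  have huu := hb.self_eq_zero u
  have hvv := hb.self_eq_zero v
  intro i j
  cases i using Fin.cases with
  | zero =>
    cases j using Fin.cases with
    | zero => simp [f, pairingMatrix, huu]
    | succ j =>
      cases j using Fin.cases with
      | zero => simp [f, pairingMatrix, hbuv]
      | succ j => simp [f, pairingMatrix, hbue]
  | succ i =>
    cases i using Fin.cases with
    | zero =>
      cases j using Fin.cases with
      | zero => simp [f, pairingMatrix, hbvu]
      | succ j =>
        cases j using Fin.cases with
        | zero => simp [f, pairingMatrix, hvv]
        | succ j => simp [f, pairingMatrix, hbve]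
    | succ i =>
      cases j using Fin.cases with
      | zero => simp [f, pairingMatrix, hbeu]
      | succ j =>
        cases j using Fin.cases with
        | zero => simp [f, pairingMatrix, hbev]
        | succ j =>
          rw [pairingMatrix_add_two]
          exact he i j

/-- Canonical pairing form of a two-fermion amplitude (skew-symmetric
Youla/Hua decomposition): every complex skew-symmetric matrix `B` can be
brought to canonical pairing form `U·B·Uᵀ = pairingMatrix n m x` with `U`
unitary (`Uᴴ·U = 1`), `2m ≤ n`, and nonnegative pair amplitudes `x`. -/
theorem skew_symmetric_pairing_decomposition
    (n : ℕ) (B : Matrix (Fin n) (Fin n) ℂ) (hB : Bᵀ = -B) :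
    ∃ (U : Matrix (Fin n) (Fin n) ℂ) (m : ℕ) (x : Fin m → ℝ),
      Uᴴ * U = 1 ∧ 2 * m ≤ n ∧ (∀ k, 0 ≤ x k) ∧
      U * B * Uᵀ = pairingMatrix n m x := by
  let b : EuclideanSpace ℂ (Fin n) →ₗ[ℂ] EuclideanSpace ℂ (Fin n) →ₗ[ℂ] ℂ :=
    LinearMap.mk₂ ℂ (fun x y => x.ofLp ⬝ᵥ B *ᵥ y.ofLp)
    (by simp [add_dotProduct]) (by simp [smul_dotProduct])
    (by simp [mulVec_add, dotProduct_add]) (by simp [mulVec_smul, dotProduct_smul])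
  have hb : b.IsAlt := fun x => by
    have h : x.ofLp ⬝ᵥ B *ᵥ x.ofLp = -(x.ofLp ⬝ᵥ B *ᵥ x.ofLp) := by
      conv_lhs => rw [dotProduct_mulVec, ← mulVec_transpose, hB, neg_mulVec, neg_dotProduct,
        dotProduct_comm]
    exact self_eq_neg.1 h
  obtain ⟨e, m, x, hm, hx, he⟩ := exists_orthonormalBasis_pairing n b hb (by simp)
  refine ⟨Matrix.of fun i a => e i a, m, x, ?_, hm, hx, ?_⟩
  · rw [mul_eq_one_comm]
    ext i j
    have h := orthonormal_iff_ite.1 e.orthonormal j i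
    simp only [PiLp.inner_apply, RCLike.inner_apply] at h
    simpa [Matrix.mul_apply, Matrix.one_apply, eq_comm] using h
  · ext i j
    rw [← he, Matrix.mul_assoc]
    simp [b, Matrix.mul_apply, dotProduct, mulVec]
end
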